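/- No edge of a cycle of zero-flow edges is an anchor edge: Let G be an undirected multigraph on V and f a maximum integral (s,t)-flow. Let k ≥ 3 and let v_0, v_1, …, v_{k−1} be pairwise distinct vertices with v_k = v_0 such that w(v_i, v_{i+1}) − f(v_i, v_{i+1}) − f(v_{i+1}, v_i) ≥ 1 for every i < k (each consecutive pair of the cycle is joined by a zero-flow edge). Then for every i < k, no (λ+1) (s,t)-cut of G separates v_i and v_{i+1}; in particular, no pair {v_i, v_{i+1}} is an anchor edge for f. -/

import Mathlib

open Finset

section Defs

variable {V : Type*} [Fintype V] [DecidableEq V]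

/-- Capacity of an `(s,t)`-cut `C` (sum of multiplicities of edges leaving `C`). -/
def capN (w : V → V → ℕ) (C : Finset V) : ℕ := ∑ u ∈ C, ∑ v ∈ Cᶜ, w u v

/-- A cut `C` separates `a` and `b` if exactly one of them lies in `C`. -/
def Separates (C : Finset V) (a b : V) : Prop :=
  (a ∈ C ∧ b ∉ C) ∨ (b ∈ C ∧ a ∉ C)

/-- Flow leaving the cut `C`. -/
def flowOut (f : V → V → ℕ) (C : Finset V) : ℕ := ∑ u ∈ C, ∑ v ∈ Cᶜ, f u v

/-- Flow entering the cut `C`. -/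
def flowIn (f : V → V → ℕ) (C : Finset V) : ℕ := ∑ u ∈ C, ∑ v ∈ Cᶜ, f v u

/-- Number of zero-flow edges across the cut `C`. -/
def zeroFlowCount (w f : V → V → ℕ) (C : Finset V) : ℕ :=
  ∑ u ∈ C, ∑ v ∈ Cᶜ, (w u v - f u v - f v u)

/-- `{a, b}` is an anchor edge for the maximum flow `f`: some edge between `a` and `b`
carries no flow, and some `(λ+1)` `(s,t)`-cut separates `a` and `b`. -/
def IsAnchor (s t : V) (w f : V → V → ℕ) (lam : ℕ) (a b : V) : Prop :=
  a ≠ b ∧ 1 ≤ w a b - f a b - f b a ∧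
    ∃ C : Finset V, s ∈ C ∧ t ∉ C ∧ capN w C = lam + 1 ∧ Separates C a b

end Defs

/-- Across a cut containing `s` but not `t`, the net flow equals the value of the flow. -/
theorem flowOut_eq_add_flowIn {V : Type*} [Fintype V] [DecidableEq V] {s t : V}
    {f : V → V → ℕ} {lam : ℕ}
    (hcons : ∀ x, x ≠ s → x ≠ t → ∑ v, f x v = ∑ v, f v x)
    (hval : ∑ v, f s v = lam + ∑ v, f v s)
    {C : Finset V} (hs : s ∈ C) (ht : t ∉ C) :
    flowOut f C = lam + flowIn f C := by
  have hout : ∑ u ∈ C, ∑ v, f u v = ∑ u ∈ C, ∑ v ∈ C, f u v + flowOut f C := by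
    simp only [flowOut, ← sum_add_distrib, sum_add_sum_compl]
  have hin : ∑ u ∈ C, ∑ v, f v u = ∑ u ∈ C, ∑ v ∈ C, f v u + flowIn f C := by
    simp only [flowIn, ← sum_add_distrib, sum_add_sum_compl]
  have hinside : ∑ u ∈ C, ∑ v ∈ C, f u v = ∑ u ∈ C, ∑ v ∈ C, f v u := sum_comm
  have hnet : ∑ u ∈ C, ∑ v, f u v = lam + ∑ u ∈ C, ∑ v, f v u := by
    rw [← add_sum_erase C _ hs, ← add_sum_erase C (fun u => ∑ v, f v u) hs, hval, add_assoc]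
    congr 2
    refine sum_congr rfl fun x hx => hcons x (ne_of_mem_erase hx) ?_
    rintro rfl
    exact ht (mem_of_mem_erase hx)
  omega

/-- The edges across a cut split into those carrying flow outwards, those carrying flow inwards
and those carrying no flow. -/
theorem capN_eq_flowOut_add_flowIn_add_zeroFlowCount {V : Type*} [Fintype V] [DecidableEq V]
    {w f : V → V → ℕ} (hflow : ∀ u v, f u v + f v u ≤ w u v) (C : Finset V) :
    capN w C = flowOut f C + flowIn f C + zeroFlowCount w f C := by
  simp only [capN, flowOut, flowIn, zeroFlowCount, ← sum_add_distrib]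
  refine sum_congr rfl fun u _ => sum_congr rfl fun v _ => ?_
  have := hflow u v
  omega

/-- Two distinct zero-flow pairs across a cut contribute at least two zero-flow edges. -/
theorem two_le_zeroFlowCount {V : Type*} [Fintype V] [DecidableEq V]
    {w f : V → V → ℕ} {C : Finset V} {a b c d : V} (ha : a ∈ C) (hb : b ∉ C) (hc : c ∈ C)
    (hd : d ∉ C) (hne : (a, b) ≠ (c, d)) (hab : 1 ≤ w a b - f a b - f b a)
    (hcd : 1 ≤ w c d - f c d - f d c) :
    2 ≤ zeroFlowCount w f C := by
  rw [zeroFlowCount, ← sum_product']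
  have hsub : ({(a, b), (c, d)} : Finset (V × V)) ⊆ C ×ˢ Cᶜ := by
    simp [insert_subset_iff, ha, hb, hc, hd]
  refine le_trans ?_ (sum_le_sum_of_subset hsub)
  rw [sum_pair hne]
  exact add_le_add hab hcd

/-- A property that is preserved along a cyclic sequence and holds somewhere holds everywhere. -/
theorem forall_of_forall_succ_of_cyclic {P : ℕ → Prop} {k : ℕ} (hcyc : P k → P 0)
    (hstep : ∀ j < k, P j → P (j + 1)) {a : ℕ} (hak : a ≤ k) (ha : P a) :
    ∀ b ≤ k, P b := by
  have hmono : ∀ i, P i → ∀ b, i ≤ b → b ≤ k → P b := by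
    intro i hi b hib
    induction b, hib using Nat.le_induction with
    | base => exact fun _ => hi
    | succ n _ ih => exact fun hn => hstep n hn (ih (by omega))
  exact fun b hb => hmono 0 (hcyc (hmono a ha k hak le_rfl)) b (Nat.zero_le b) hb

/-- No edge of a cycle of zero-flow edges is an anchor edge: no `(λ+1)` `(s,t)`-cut
separates two consecutive vertices of such a cycle. -/
theorem no_anchor_edge_on_zeroFlow_cycle
    {V : Type*} [Fintype V] [DecidableEq V] (s t : V) (hst : s ≠ t)
    (w f : V → V → ℕ)
    (hsym : ∀ u v, w u v = w v u) (hwdiag : ∀ v, w v v = 0)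
    (hflow : ∀ u v, f u v + f v u ≤ w u v)
    (hcons : ∀ x, x ≠ s → x ≠ t → ∑ v, f x v = ∑ v, f v x)
    (lam : ℕ)
    (hlam : IsLeast {x : ℕ | ∃ C : Finset V, s ∈ C ∧ t ∉ C ∧ capN w C = x} lam)
    (hval : ∑ v, f s v = lam + ∑ v, f v s)
    (k : ℕ) (hk : 3 ≤ k) (v : ℕ → V)
    (hdist : ∀ i < k, ∀ j < k, i ≠ j → v i ≠ v j)
    (hcyc : v k = v 0)
    (hzero : ∀ i < k, 1 ≤ w (v i) (v (i + 1)) - f (v i) (v (i + 1)) - f (v (i + 1)) (v i)) :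
    ∀ i < k, ∀ C : Finset V, s ∈ C → t ∉ C → capN w C = lam + 1 →
      ¬ Separates C (v i) (v (i + 1)) := by
  intro i hi C hs ht hcap hsep
  have hle : zeroFlowCount w f C ≤ 1 := by
    have h₁ := flowOut_eq_add_flowIn hcons hval hs ht
    have h₂ := capN_eq_flowOut_add_flowIn_add_zeroFlowCount hflow C
    omega
  have hinj : ∀ a < k, ∀ b ≤ k, v a = v b → a = b ∨ (a = 0 ∧ b = k) := by
    intro a ha b hb hab
    rcases hb.lt_or_eq with hb | rfl
    · by_contra h
      exact hdist a ha b hb (fun hab' => h (Or.inl hab')) hab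
    · refine Or.inr ⟨?_, rfl⟩
      by_contra h
      exact hdist a ha 0 (by omega) h (hab.trans hcyc)
  have hcross : ∀ a < k, ∀ b < k, v a ∈ C → v (a + 1) ∉ C → v b ∉ C → v (b + 1) ∈ C →
      False := by
    intro a ha b hb ha₁ ha₂ hb₁ hb₂
    have hne : (v a, v (a + 1)) ≠ (v (b + 1), v b) := by
      intro h
      rw [Prod.mk.injEq] at h
      have h₁ := hinj a ha (b + 1) hb h.1
      have h₂ := hinj b hb (a + 1) ha h.2.symm
      omega
    have hb₃ : 1 ≤ w (v (b + 1)) (v b) - f (v (b + 1)) (v b) - f (v b) (v (b + 1)) := by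
      rw [hsym, Nat.sub_right_comm]
      exact hzero b hb
    have := two_le_zeroFlowCount ha₁ ha₂ hb₂ hb₁ hne (hzero a ha) hb₃
    omega
  rcases hsep with ⟨h₁, h₂⟩ | ⟨h₁, h₂⟩
  · exact forall_of_forall_succ_of_cyclic (P := fun j => v j ∉ C) (fun h => hcyc ▸ h)
      (fun b hb hb₁ hb₂ => hcross i hi b hb h₁ h₂ hb₁ hb₂) hi h₂ i hi.le h₁
  · exact h₂ (forall_of_forall_succ_of_cyclic (P := fun j => v j ∈ C) (fun h => hcyc ▸ h)
      (fun a ha ha₁ => by_contra fun ha₂ => hcross a ha i hi ha₁ ha₂ h₂ h₁) hi h₁ i hi.le)
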